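/- Let n ≥ 2, γ ∈ ℝ with γ ≤ p − n, and n < p < +∞. There exists a constant C > 0, depending only on n, γ and p, such that every u ∈ C_c^∞(ℝⁿ₊) satisfies, for all x, y ∈ ℝⁿ₊, |u(x) − u(y)| ≤ C · max(xₙ, yₙ)^{1 − (n+γ)/p} · |x − y|^{1 − n/p} / max(xₙ, yₙ, |x − y|)^{1 − n/p} · E_γ(u)^{1/p}. -/

import Mathlib

open MeasureTheory Real Set
open scoped ENNReal

noncomputable section

/-- The last coordinate `xₙ` of a point of `ℝⁿ`. -/
def lastCoord (n : ℕ) (x : EuclideanSpace ℝ (Fin n)) : ℝ :=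
  if h : 0 < n then x ⟨n - 1, Nat.sub_lt h one_pos⟩ else 0

/-- The open upper half-space `ℝⁿ₊`. -/
def upperHalf (n : ℕ) : Set (EuclideanSpace ℝ (Fin n)) :=
  {z | 0 < lastCoord n z}

/-- The weighted energy `E_γ(u) = ∫_{ℝⁿ₊} ‖Du(z)‖^p zₙ^γ dz`, as a value in `[0, +∞]`. -/
def energy (n : ℕ) (γ p : ℝ) (u : EuclideanSpace ℝ (Fin n) → ℝ) : ℝ≥0∞ :=
  ∫⁻ z in upperHalf n, ENNReal.ofReal (‖fderiv ℝ u z‖ ^ p * lastCoord n z ^ γ)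

theorem enorm_sub_le_lintegral_fderiv {E : Type*} [NormedAddCommGroup E] [NormedSpace ℝ E]
    {u : E → ℝ} (hu : ContDiff ℝ 1 u) (x w : E) :
    ‖u w - u x‖ₑ ≤
      ‖w - x‖ₑ * ∫⁻ s in Ioc (0 : ℝ) 1, ‖fderiv ℝ u (x + s • (w - x))‖ₑ := by
  have hDu : Continuous (fderiv ℝ u) := hu.continuous_fderiv one_ne_zero
  have hderiv (s : ℝ) : HasDerivAt (fun s : ℝ => u (x + s • (w - x)))
      (fderiv ℝ u (x + s • (w - x)) (w - x)) s := by
    have h1 : HasDerivAt (fun s : ℝ => x + s • (w - x)) (w - x) s := by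
      simpa using ((hasDerivAt_id s).smul_const (w - x)).const_add x
    exact ((hu.differentiable one_ne_zero) _).hasFDerivAt.comp_hasDerivAt s h1
  have hcont : Continuous fun s : ℝ => fderiv ℝ u (x + s • (w - x)) (w - x) := by fun_prop
  have hftc := intervalIntegral.integral_eq_sub_of_hasDerivAt (a := 0) (b := 1)
    (fun s _ => hderiv s) (hcont.intervalIntegrable 0 1)
  simp only [one_smul, zero_smul, add_zero, add_sub_cancel] at hftc
  rw [← hftc, intervalIntegral.integral_of_le zero_le_one]
  refine (enorm_integral_le_lintegral_enorm _).trans ?_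
  rw [← lintegral_const_mul' _ _ enorm_ne_top]
  refine lintegral_mono fun s => ?_
  rw [mul_comm]
  exact ContinuousLinearMap.le_opENorm _ _

theorem lintegral_comp_add_smul_sub {E : Type*} [NormedAddCommGroup E] [NormedSpace ℝ E]
    [MeasurableSpace E] [BorelSpace E] [FiniteDimensional ℝ E] (μ : Measure E)
    [μ.IsAddHaarMeasure] {F : E → ℝ≥0∞} (hF : Measurable F) (x : E) {s : ℝ} (hs : 0 < s) :
    ∫⁻ w, F (x + s • (w - x)) ∂μ =
      ENNReal.ofReal ((s ^ Module.finrank ℝ E)⁻¹) * ∫⁻ z, F z ∂μ := by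
  have h1 := lintegral_sub_right_eq_self (μ := μ) (fun w => F (x + s • w)) x
  rw [h1, ← lintegral_add_left_eq_self (μ := μ) F x,
    ← lintegral_map (f := fun z => F (x + z)) (g := fun w => s • w) (by fun_prop) (by fun_prop),
    Measure.map_addHaar_smul μ hs.ne', lintegral_smul_measure, smul_eq_mul,
    abs_of_pos (by positivity)]

theorem setLIntegral_ball_enorm_sub_le {E : Type*} [NormedAddCommGroup E] [NormedSpace ℝ E]
    [MeasurableSpace E] [BorelSpace E] [FiniteDimensional ℝ E] (μ : Measure E)
    [μ.IsAddHaarMeasure] {u : E → ℝ} (hu : ContDiff ℝ 1 u) {x c : E} {r R : ℝ}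
    (hR : ‖c - x‖ + r ≤ R) :
    ∫⁻ w in Metric.ball c r, ‖u w - u x‖ₑ ∂μ ≤
      ENNReal.ofReal R * ∫⁻ s in Ioc (0 : ℝ) 1,
        ENNReal.ofReal ((s ^ Module.finrank ℝ E)⁻¹) *
          ∫⁻ z in Metric.ball (x + s • (c - x)) (s * r), ‖fderiv ℝ u z‖ₑ ∂μ := by
  have hDu : Continuous (fderiv ℝ u) := hu.continuous_fderiv one_ne_zero
  calc ∫⁻ w in Metric.ball c r, ‖u w - u x‖ₑ ∂μ
      ≤ ∫⁻ w in Metric.ball c r, ENNReal.ofReal R *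
          (∫⁻ s in Ioc (0 : ℝ) 1, ‖fderiv ℝ u (x + s • (w - x))‖ₑ) ∂μ := by
        refine setLIntegral_mono' measurableSet_ball fun w hw => ?_
        refine (enorm_sub_le_lintegral_fderiv hu x w).trans ?_
        gcongr
        rw [← ofReal_norm]
        refine ENNReal.ofReal_le_ofReal ?_
        have h1 : ‖w - c‖ < r := by simpa [dist_eq_norm] using hw
        have h2 := norm_add_le (w - c) (c - x)
        rw [sub_add_sub_cancel] at h2
        linarith
    _ = ENNReal.ofReal R * ∫⁻ s in Ioc (0 : ℝ) 1,
          ∫⁻ w in Metric.ball c r, ‖fderiv ℝ u (x + s • (w - x))‖ₑ ∂μ := by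
        rw [lintegral_const_mul' _ _ ENNReal.ofReal_ne_top, lintegral_lintegral_swap]
        have : Continuous fun q : E × ℝ => fderiv ℝ u (x + q.2 • (q.1 - x)) := by fun_prop
        exact this.enorm.measurable.aemeasurable
    _ = _ := by
        congr 1
        refine setLIntegral_congr_fun measurableSet_Ioc fun s hs => ?_
        have hs0 : 0 < s := hs.1
        rw [← lintegral_indicator measurableSet_ball, ← lintegral_indicator measurableSet_ball,
          ← lintegral_comp_add_smul_sub μ (hDu.enorm.measurable.indicator measurableSet_ball) x hs0]
        refine lintegral_congr fun w => ?_
        have hmem : x + s • (w - x) ∈ Metric.ball (x + s • (c - x)) (s * r) ↔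
            w ∈ Metric.ball c r := by
          rw [mem_ball_iff_norm, mem_ball_iff_norm, add_sub_add_left_eq_sub, ← smul_sub,
            sub_sub_sub_cancel_right, norm_smul, Real.norm_of_nonneg hs0.le,
            mul_lt_mul_iff_right₀ hs0]
        by_cases h : w ∈ Metric.ball c r
        · rw [indicator_of_mem h, indicator_of_mem (hmem.2 h)]
        · rw [indicator_of_notMem h, indicator_of_notMem (mt hmem.1 h)]

theorem setLIntegral_ball_comp_coord_le {ι : Type*} [Fintype ι] [DecidableEq ι]
    (c : EuclideanSpace ℝ ι) (R : ℝ) (i : ι) {F : ℝ → ℝ≥0∞} (hF : Measurable F) :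
    ∫⁻ z in Metric.ball c R, F (z i) ≤
      ENNReal.ofReal (2 * R) ^ (Fintype.card ι - 1) *
        ∫⁻ t in Ioo (c i - R) (c i + R), F t := by
  set B : Set (ι → ℝ) := univ.pi fun j => Ioo (c j - R) (c j + R)
  have hsub : Metric.ball c R ⊆ (fun z : EuclideanSpace ℝ ι => WithLp.ofLp z) ⁻¹' B := by
    intro z hz j _
    have h1 : |z j - c j| < R :=
      lt_of_le_of_lt (by simpa using PiLp.norm_apply_le (z - c) j) (mem_ball_iff_norm.1 hz)
    rw [abs_lt] at h1
    exact ⟨by linarith [h1.1], by linarith [h1.2]⟩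
  calc ∫⁻ z in Metric.ball c R, F (z i)
      ≤ ∫⁻ z in (fun z : EuclideanSpace ℝ ι => WithLp.ofLp z) ⁻¹' B, F (z i) :=
        lintegral_mono_set hsub
    _ = ∫⁻ y in B, F (y i) :=
        (PiLp.volume_preserving_ofLp ι).setLIntegral_comp_preimage
          (MeasurableSet.univ_pi fun _ => measurableSet_Ioo) (hF.comp (measurable_pi_apply i))
    _ = ∫⁻ t, F t ∂((volume.restrict B).map (Function.eval i)) :=
        (lintegral_map hF (measurable_pi_apply i)).symm
    _ = _ := by
        rw [volume_pi, Measure.restrict_pi_pi, Measure.pi_map_eval, lintegral_smul_measure]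
        simp [Finset.prod_const, ← two_mul]

/-- Hölder's inequality with the weight `d ^ γ`, for a function vanishing outside `U`. -/
theorem setLIntegral_le_rpow_mul_rpow {α : Type*} [MeasurableSpace α] (μ : Measure α)
    {S U : Set α} (hS : MeasurableSet S) (hU : MeasurableSet U) {p q : ℝ}
    (hpq : p.HolderConjugate q)
    {g : α → ℝ} (hg : Measurable g) (hg0 : ∀ z, 0 ≤ g z) (hgU : ∀ z ∉ U, g z = 0)
    {d : α → ℝ} (hd : Measurable d) (hdU : ∀ z ∈ U, 0 < d z) (γ : ℝ) :
    ∫⁻ z in S, ENNReal.ofReal (g z) ∂μ ≤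
      (∫⁻ z in U, ENNReal.ofReal (g z ^ p * d z ^ γ) ∂μ) ^ (1 / p) *
      (∫⁻ z in S ∩ U, ENNReal.ofReal (d z ^ (-(γ / (p - 1)))) ∂μ) ^ (1 / q) := by
  have hp := hpq.pos
  have hq := hpq.symm.pos
  have hqp : q / p = 1 / (p - 1) := by
    rw [hpq.conjugate_eq]
    have := hpq.sub_one_pos
    field_simp
  calc ∫⁻ z in S, ENNReal.ofReal (g z) ∂μ
      = ∫⁻ z in S ∩ U, ENNReal.ofReal (g z) ∂μ := by
        rw [inter_comm, ← setLIntegral_indicator hU]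
        refine lintegral_congr fun z => ?_
        by_cases hz : z ∈ U <;> simp [hz, hgU]
    _ = ∫⁻ z in S ∩ U, ((fun z => ENNReal.ofReal (g z * d z ^ (γ / p))) *
          fun z => ENNReal.ofReal (d z ^ (-(γ / p)))) z ∂μ := by
        refine setLIntegral_congr_fun (hS.inter hU) fun z hz => ?_
        have hz0 := hdU z hz.2
        simp only [Pi.mul_apply]
        rw [← ENNReal.ofReal_mul (mul_nonneg (hg0 z) (by positivity)), mul_assoc,
          ← Real.rpow_add hz0, add_neg_cancel, Real.rpow_zero, mul_one]
    _ ≤ _ := ENNReal.lintegral_mul_le_Lp_mul_Lq _ hpq (by fun_prop) (by fun_prop)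
    _ = (∫⁻ z in S ∩ U, ENNReal.ofReal (g z ^ p * d z ^ γ) ∂μ) ^ (1 / p) *
        (∫⁻ z in S ∩ U, ENNReal.ofReal (d z ^ (-(γ / (p - 1)))) ∂μ) ^ (1 / q) := by
        congr 2
        · refine setLIntegral_congr_fun (hS.inter hU) fun z hz => ?_
          have hz0 := hdU z hz.2
          have hg0 := hg0 z
          rw [ENNReal.ofReal_rpow_of_nonneg (by positivity) hp.le,
            Real.mul_rpow hg0 (by positivity), ← Real.rpow_mul hz0.le, div_mul_cancel₀ _ hp.ne']
        · refine setLIntegral_congr_fun (hS.inter hU) fun z hz => ?_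
          have hz0 := hdU z hz.2
          rw [ENNReal.ofReal_rpow_of_nonneg (by positivity) hq.le, ← Real.rpow_mul hz0.le]
          congr 2
          rw [neg_mul, div_mul_eq_mul_div, mul_div_assoc, hqp, mul_one_div]
    _ ≤ _ := by
        gcongr
        exact inter_subset_right

theorem setLIntegral_ball_enorm_sub_le_weighted {E : Type*} [NormedAddCommGroup E]
    [NormedSpace ℝ E] [MeasurableSpace E] [BorelSpace E] [FiniteDimensional ℝ E] (μ : Measure E)
    [μ.IsAddHaarMeasure] {u : E → ℝ} (hu : ContDiff ℝ 1 u) {U : Set E} (hU : MeasurableSet U)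
    (huU : ∀ z ∉ U, fderiv ℝ u z = 0) {d : E → ℝ} (hd : Measurable d) (hdU : ∀ z ∈ U, 0 < d z)
    {p q γ : ℝ} (hpq : p.HolderConjugate q) (hnp : (Module.finrank ℝ E : ℝ) < p)
    (hfin : ∫⁻ z in U, ENNReal.ofReal (‖fderiv ℝ u z‖ ^ p * d z ^ γ) ∂μ ≠ ∞)
    {x c : E} {r R K : ℝ} (hR0 : 0 ≤ R) (hR : ‖c - x‖ + r ≤ R) (hK0 : 0 ≤ K)
    (hK : ∀ s ∈ Ioc (0 : ℝ) 1,
      ∫⁻ z in Metric.ball (x + s • (c - x)) (s * r) ∩ U,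
        ENNReal.ofReal (d z ^ (-(γ / (p - 1)))) ∂μ ≤
          ENNReal.ofReal (K * s ^ Module.finrank ℝ E)) :
    ∫⁻ w in Metric.ball c r, ‖u w - u x‖ₑ ∂μ ≤
      ENNReal.ofReal (R * (1 - Module.finrank ℝ E / p)⁻¹ * K ^ (1 / q) *
        (∫⁻ z in U, ENNReal.ofReal (‖fderiv ℝ u z‖ ^ p * d z ^ γ) ∂μ).toReal ^ (1 / p)) := by
  set n := Module.finrank ℝ E
  set e := ∫⁻ z in U, ENNReal.ofReal (‖fderiv ℝ u z‖ ^ p * d z ^ γ) ∂μ with he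
  have hp := hpq.pos
  have hq := hpq.symm.pos
  have hnp1 : (n : ℝ) / p < 1 := (div_lt_one hp).2 hnp
  have hDu : Continuous (fderiv ℝ u) := hu.continuous_fderiv one_ne_zero
  have hint : ∫⁻ s in Ioc (0 : ℝ) 1, ENNReal.ofReal (s ^ (-((n : ℝ) / p))) =
      ENNReal.ofReal (1 - n / p)⁻¹ := by
    have hi := intervalIntegral.intervalIntegrable_rpow' (a := 0) (b := 1)
      (r := -((n : ℝ) / p)) (by linarith)
    rw [← ofReal_integral_eq_lintegral_ofReal
      ((intervalIntegrable_iff_integrableOn_Ioc_of_le zero_le_one).1 hi),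
      ← intervalIntegral.integral_of_le zero_le_one, integral_rpow (Or.inl (by linarith))]
    · rw [Real.one_rpow, Real.zero_rpow (by linarith), sub_zero, one_div, neg_add_eq_sub]
    · refine (ae_restrict_mem measurableSet_Ioc).mono fun s hs => ?_
      exact Real.rpow_nonneg hs.1.le _
  refine (setLIntegral_ball_enorm_sub_le μ hu hR).trans ?_
  calc _ ≤ ENNReal.ofReal R * ∫⁻ s in Ioc (0 : ℝ) 1,
        ENNReal.ofReal (K ^ (1 / q) * e.toReal ^ (1 / p)) *
          ENNReal.ofReal (s ^ (-((n : ℝ) / p))) := by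
        refine mul_le_mul' le_rfl ?_
        refine setLIntegral_mono' measurableSet_Ioc fun s hs => ?_
        have hs0 : 0 < s := hs.1
        have h1 := setLIntegral_le_rpow_mul_rpow μ
          (S := Metric.ball (x + s • (c - x)) (s * r)) measurableSet_ball hU hpq
          (g := fun z => ‖fderiv ℝ u z‖) hDu.norm.measurable (fun _ => norm_nonneg _)
          (fun z hz => by simp [huU z hz]) hd hdU γ
        simp only [ofReal_norm, ← he] at h1
        have h2 : ENNReal.ofReal (K * s ^ n) ^ (1 / q) =
            ENNReal.ofReal (K ^ (1 / q) * s ^ (n / q)) := by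
          rw [ENNReal.ofReal_rpow_of_nonneg (by positivity) (by positivity),
            Real.mul_rpow hK0 (by positivity), ← Real.rpow_natCast, ← Real.rpow_mul hs0.le,
            mul_one_div]
        have h3 : e ^ (1 / p) = ENNReal.ofReal (e.toReal ^ (1 / p)) := by
          rw [← ENNReal.ofReal_rpow_of_nonneg ENNReal.toReal_nonneg (by positivity),
            ENNReal.ofReal_toReal hfin]
        calc _ ≤ ENNReal.ofReal ((s ^ n)⁻¹) *
              (e ^ (1 / p) * ENNReal.ofReal (K * s ^ n) ^ (1 / q)) := by
              gcongr
              exact h1.trans (by gcongr; exact hK s hs)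
          _ = _ := by
              rw [h2, h3, ← ENNReal.ofReal_mul (by positivity), ← ENNReal.ofReal_mul (by positivity),
                ← ENNReal.ofReal_mul (by positivity)]
              congr 1
              have h4 : s ^ (-((n : ℝ) / p)) = (s ^ n)⁻¹ * s ^ ((n : ℝ) / q) := by
                rw [← Real.rpow_natCast, ← Real.rpow_neg hs0.le, ← Real.rpow_add hs0]
                congr 1
                have := hpq.inv_add_inv_eq_one
                rw [div_eq_mul_inv, div_eq_mul_inv]
                linear_combination (n : ℝ) * (-1) * this
              rw [h4]
              ring
    _ = _ := by
        rw [lintegral_const_mul' _ _ ENNReal.ofReal_ne_top, hint,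
          ← ENNReal.ofReal_mul (by positivity), ← ENNReal.ofReal_mul (by positivity)]
        congr 1
        ring

theorem abs_sub_mul_measureReal_le {E : Type*} [MeasurableSpace E] {μ : Measure E} {S : Set E}
    {u : E → ℝ} (hu : Measurable u) {x y : E} {a b : ℝ} (ha : 0 ≤ a) (hb : 0 ≤ b)
    (hx : ∫⁻ w in S, ‖u w - u x‖ₑ ∂μ ≤ ENNReal.ofReal a)
    (hy : ∫⁻ w in S, ‖u w - u y‖ₑ ∂μ ≤ ENNReal.ofReal b) :
    |u x - u y| * μ.real S ≤ a + b := by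
  have h : ‖u x - u y‖ₑ * μ S ≤ ENNReal.ofReal (a + b) := by
    rw [← setLIntegral_const, ENNReal.ofReal_add ha hb]
    refine le_trans ?_ (add_le_add hx hy)
    rw [← lintegral_add_left (by fun_prop)]
    refine lintegral_mono fun w => ?_
    rw [← enorm_neg (u w - u x)]
    simpa using enorm_add_le (-(u w - u x)) (u w - u y)
  have h2 := ENNReal.toReal_mono ENNReal.ofReal_ne_top h
  rwa [ENNReal.toReal_mul, toReal_enorm, Real.norm_eq_abs, ENNReal.toReal_ofReal (by positivity)]
    at h2

theorem rpow_neg_le_of_mem_Icc {a h t : ℝ} (ha : 1 ≤ a) (hh : 0 < h)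
    (ht : t ∈ Icc (h / a) (a * h)) (β : ℝ) : t ^ (-β) ≤ a ^ |β| * h ^ (-β) := by
  have ha0 : 0 < a := by linarith
  have ht0 : 0 < t := lt_of_lt_of_le (by positivity) ht.1
  rw [Real.rpow_def_of_pos ht0, Real.rpow_def_of_pos hh, Real.rpow_def_of_pos ha0, ← Real.exp_add,
    Real.exp_le_exp]
  have h1 := Real.log_le_log (by positivity) ht.1
  have h2 := Real.log_le_log ht0 ht.2
  rw [Real.log_div hh.ne' ha0.ne'] at h1
  rw [Real.log_mul ha0.ne' hh.ne'] at h2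
  have h3 : |Real.log t - Real.log h| ≤ Real.log a := abs_le.2 ⟨by linarith, by linarith⟩
  have h4 := mul_le_mul_of_nonneg_right h3 (abs_nonneg β)
  rw [← abs_mul] at h4
  linarith [neg_le_abs ((Real.log t - Real.log h) * β)]

theorem exists_setLIntegral_Ioo_rpow_neg_le {β : ℝ} (hβ : β < 1) :
    ∃ C : ℝ, 0 < C ∧ ∀ h : ℝ, 0 < h → ∀ s ∈ Ioc (0 : ℝ) 1,
      ∫⁻ t in Ioo (h - 2 * s * h - s * h) (h - 2 * s * h + s * h) ∩ Ioi 0,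
        ENNReal.ofReal (t ^ (-β)) ≤ ENNReal.ofReal (C * s * h ^ (1 - β)) := by
  have hβ' : 0 < 1 - β := by linarith
  refine ⟨2 * 4 ^ |β| + 4 * (1 - β)⁻¹, by positivity, fun h hh s hs => ?_⟩
  have hs0 : 0 < s := hs.1
  rcases le_total s (1 / 4) with hs4 | hs4
  · calc _ ≤ ∫⁻ t in Ioo (h - 2 * s * h - s * h) (h - 2 * s * h + s * h),
          ENNReal.ofReal (t ^ (-β)) := lintegral_mono_set inter_subset_left
      _ ≤ ∫⁻ t in Ioo (h - 2 * s * h - s * h) (h - 2 * s * h + s * h),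
          ENNReal.ofReal (4 ^ |β| * h ^ (-β)) := by
          refine setLIntegral_mono' measurableSet_Ioo fun t ht => ENNReal.ofReal_le_ofReal ?_
          refine rpow_neg_le_of_mem_Icc (by norm_num) hh ⟨?_, ?_⟩ β
          · nlinarith [ht.1]
          · nlinarith [ht.2]
      _ = ENNReal.ofReal (2 * 4 ^ |β| * s * h ^ (1 - β)) := by
          rw [setLIntegral_const, Real.volume_Ioo, ← ENNReal.ofReal_mul (by positivity),
            sub_eq_neg_add 1 β, Real.rpow_add_one hh.ne']
          congr 1
          ring
      _ ≤ _ := by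
          apply ENNReal.ofReal_le_ofReal
          gcongr
          linarith [inv_pos.2 hβ']
  · have hi := intervalIntegral.intervalIntegrable_rpow' (a := 0) (b := h) (r := -β) (by linarith)
    calc _ ≤ ∫⁻ t in Ioc 0 h, ENNReal.ofReal (t ^ (-β)) := by
          refine lintegral_mono_set fun t ht => ⟨ht.2, ?_⟩
          nlinarith [ht.1.2]
      _ = ENNReal.ofReal (h ^ (1 - β) / (1 - β)) := by
          rw [← ofReal_integral_eq_lintegral_ofReal
            ((intervalIntegrable_iff_integrableOn_Ioc_of_le hh.le).1 hi),
            ← intervalIntegral.integral_of_le hh.le, integral_rpow (Or.inl (by linarith))]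
          · rw [neg_add_eq_sub, Real.zero_rpow hβ'.ne', sub_zero]
          · filter_upwards [ae_restrict_mem measurableSet_Ioc] with s hs
            exact Real.rpow_nonneg hs.1.le _
      _ ≤ _ := by
          apply ENNReal.ofReal_le_ofReal
          calc h ^ (1 - β) / (1 - β) ≤ (4 * s) * (h ^ (1 - β) / (1 - β)) :=
                le_mul_of_one_le_left (by positivity) (by linarith)
            _ = (4 * (1 - β)⁻¹) * s * h ^ (1 - β) := by ring
            _ ≤ _ := by
                gcongr
                linarith [show (0 : ℝ) < 4 ^ |β| by positivity]

theorem lastCoord_eq {n : ℕ} (hn : 0 < n) (x : EuclideanSpace ℝ (Fin n)) :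
    lastCoord n x = x ⟨n - 1, Nat.sub_lt hn one_pos⟩ :=
  dif_pos hn

theorem continuous_lastCoord (n : ℕ) : Continuous (lastCoord n) := by
  unfold lastCoord
  split_ifs <;> fun_prop

theorem measurableSet_upperHalf (n : ℕ) : MeasurableSet (upperHalf n) :=
  measurableSet_lt measurable_const (continuous_lastCoord n).measurable

theorem abs_lastCoord_sub_le {n : ℕ} (hn : 0 < n) (x y : EuclideanSpace ℝ (Fin n)) :
    |lastCoord n x - lastCoord n y| ≤ ‖x - y‖ := by
  rw [lastCoord_eq hn, lastCoord_eq hn]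
  simpa using PiLp.norm_apply_le (x - y) ⟨n - 1, Nat.sub_lt hn one_pos⟩

theorem fderiv_eq_zero_of_notMem_upperHalf {n : ℕ} {u : EuclideanSpace ℝ (Fin n) → ℝ}
    (hu : tsupport u ⊆ upperHalf n) {z : EuclideanSpace ℝ (Fin n)} (hz : z ∉ upperHalf n) :
    fderiv ℝ u z = 0 := by
  by_contra h
  exact hz (hu (support_fderiv_subset ℝ h))

theorem energy_ne_top {n : ℕ} {γ p : ℝ} (hp : 0 < p) {u : EuclideanSpace ℝ (Fin n) → ℝ}
    (hu : ContDiff ℝ 1 u) (hc : HasCompactSupport u) (hU : tsupport u ⊆ upperHalf n) :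
    energy n γ p u ≠ ∞ := by
  have hDu : Continuous (fderiv ℝ u) := hu.continuous_fderiv one_ne_zero
  have hcont : ContinuousOn (fun z => ‖fderiv ℝ u z‖ ^ p * lastCoord n z ^ γ) (tsupport u) := by
    refine ContinuousOn.mul ?_ ?_
    · exact (hDu.norm.rpow_const fun _ => Or.inr hp.le).continuousOn
    · exact (continuous_lastCoord n).continuousOn.rpow_const fun z hz => Or.inl (hU hz).ne'
  have hint : IntegrableOn (fun z => ‖fderiv ℝ u z‖ ^ p * lastCoord n z ^ γ) (tsupport u) :=
    hcont.integrableOn_compact hc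
  refine ne_top_of_le_ne_top hint.lintegral_lt_top.ne ?_
  rw [energy, ← lintegral_indicator (measurableSet_upperHalf n),
    ← lintegral_indicator (isClosed_tsupport u).measurableSet]
  refine lintegral_mono fun z => ?_
  by_cases hz : z ∈ tsupport u
  · rw [indicator_of_mem hz, indicator_of_mem (hU hz)]
  · have : fderiv ℝ u z = 0 := by
      by_contra h
      exact hz (support_fderiv_subset ℝ h)
    simp [this, Real.zero_rpow hp.ne', indicator]

/-- Interior Morrey estimate at a scale small compared with the distance to the boundary. -/
theorem exists_abs_sub_le_of_norm_sub_le {n : ℕ} (hn : 0 < n) {p : ℝ} (γ : ℝ) (hp1 : 1 < p)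
    (hnp : (n : ℝ) < p) :
    ∃ C : ℝ, 0 < C ∧ ∀ u : EuclideanSpace ℝ (Fin n) → ℝ, ContDiff ℝ 1 u → HasCompactSupport u →
      tsupport u ⊆ upperHalf n → ∀ x ∈ upperHalf n, ∀ y, 4 * ‖x - y‖ ≤ lastCoord n x →
        |u x - u y| ≤ C * (lastCoord n x ^ (-(γ / p)) * ‖x - y‖ ^ (1 - (n : ℝ) / p)) *
          (energy n γ p u).toReal ^ (1 / p) := by
  have hp0 : 0 < p := by linarith
  obtain ⟨q, hpq⟩ : ∃ q, p.HolderConjugate q := ⟨_, Real.HolderConjugate.conjExponent hp1⟩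
  have hq0 := hpq.symm.pos
  have hnp1 : 0 < 1 - (n : ℝ) / p := by linarith [(div_lt_one hp0).2 hnp]
  set β := γ / (p - 1) with hβ
  have hβq : β * (1 / q) = γ / p := by
    rw [hpq.conjugate_eq, hβ]
    have := hpq.sub_one_pos
    field_simp
  set v := (volume : Measure (EuclideanSpace ℝ (Fin n))).real (Metric.ball 0 1) with hv
  have hv0 : 0 < v :=
    ENNReal.toReal_pos (Metric.measure_ball_pos _ _ one_pos).ne' measure_ball_lt_top.ne
  have hvball (c : EuclideanSpace ℝ (Fin n)) {r : ℝ} (hr : 0 < r) :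
      volume (Metric.ball c r) = ENNReal.ofReal (r ^ n * v) := by
    rw [Measure.addHaar_ball_of_pos _ _ hr, finrank_euclideanSpace_fin,
      ENNReal.ofReal_mul (by positivity), hv, ofReal_measureReal measure_ball_lt_top.ne]
  refine ⟨4 * (1 - (n : ℝ) / p)⁻¹ * (2 ^ |β| * v) ^ (1 / q) / v, by positivity,
    fun u hu hc hU x hx y hxy => ?_⟩
  have hx0 : 0 < lastCoord n x := hx
  rcases (norm_nonneg (x - y)).eq_or_lt with hd | hd
  · have : x = y := sub_eq_zero.1 (norm_eq_zero.1 hd.symm)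
    subst this
    rw [sub_self, abs_zero]
    positivity
  set M := lastCoord n x with hM
  set d := ‖x - y‖ with hd'
  set e := (energy n γ p u).toReal with he
  have key (b : EuclideanSpace ℝ (Fin n)) (hb : ‖x - b‖ ≤ d) :
      ∫⁻ w in Metric.ball x d, ‖u w - u b‖ₑ ≤
        ENNReal.ofReal (2 * d * (1 - n / p)⁻¹ * (2 ^ |β| * M ^ (-β) * d ^ n * v) ^ (1 / q) *
          e ^ (1 / p)) := by
    have := setLIntegral_ball_enorm_sub_le_weighted volume hu (measurableSet_upperHalf n)
      (fun z hz => fderiv_eq_zero_of_notMem_upperHalf hU hz) (continuous_lastCoord n).measurable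
      (fun z hz => hz) hpq (by simpa using hnp) (energy_ne_top (γ := γ) hp0 hu hc hU)
      (x := b) (c := x) (r := d) (R := 2 * d) (K := 2 ^ |β| * M ^ (-β) * d ^ n * v)
      (by positivity) (by linarith) (by positivity) ?_
    · rw [finrank_euclideanSpace_fin] at this
      exact this
    · intro s hs
      rw [finrank_euclideanSpace_fin]
      have hs0 : 0 < s := hs.1
      calc _ ≤ ∫⁻ z in Metric.ball (b + s • (x - b)) (s * d) ∩ upperHalf n,
              ENNReal.ofReal (2 ^ |β| * M ^ (-β)) := by
            refine setLIntegral_mono' (measurableSet_ball.inter (measurableSet_upperHalf n))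
              fun z hz => ENNReal.ofReal_le_ofReal ?_
            refine rpow_neg_le_of_mem_Icc one_le_two hx0 ?_ β
            have h1 := mem_ball_iff_norm.1 hz.1
            have h2 : ‖(b + s • (x - b)) - x‖ ≤ (1 - s) * d := by
              have : (b + s • (x - b)) - x = -((1 - s) • (x - b)) := by module
              rw [this, norm_neg, norm_smul, Real.norm_of_nonneg (by linarith [hs.2])]
              gcongr
              linarith [hs.2]
            have h3 := norm_add_le (z - (b + s • (x - b))) ((b + s • (x - b)) - x)
            rw [sub_add_sub_cancel] at h3
            have h4 := abs_le.1 ((abs_lastCoord_sub_le hn z x).trans h3)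
            constructor <;> linarith [h4.1, h4.2]
        _ ≤ ∫⁻ z in Metric.ball (b + s • (x - b)) (s * d),
              ENNReal.ofReal (2 ^ |β| * M ^ (-β)) := lintegral_mono_set inter_subset_left
        _ = _ := by
            rw [setLIntegral_const, hvball _ (by positivity), ← ENNReal.ofReal_mul (by positivity)]
            congr 1
            ring
  have h := abs_sub_mul_measureReal_le hu.continuous.measurable (by positivity) (by positivity)
    (key x (by simp [hd.le])) (key y le_rfl)
  rw [measureReal_def, hvball x hd, ENNReal.toReal_ofReal (by positivity)] at h
  have hK : (2 ^ |β| * M ^ (-β) * d ^ n * v) ^ (1 / q) =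
      (2 ^ |β| * v) ^ (1 / q) * M ^ (-(γ / p)) * d ^ ((n : ℝ) / q) := by
    rw [show 2 ^ |β| * M ^ (-β) * d ^ n * v = (2 ^ |β| * v) * M ^ (-β) * d ^ n by ring,
      Real.mul_rpow (by positivity) (by positivity), Real.mul_rpow (by positivity) (by positivity),
      ← Real.rpow_mul hx0.le, neg_mul, hβq, ← Real.rpow_natCast, ← Real.rpow_mul hd.le,
      mul_one_div]
  have hdd : d * d ^ ((n : ℝ) / q) = d ^ n * d ^ (1 - (n : ℝ) / p) := by
    rw [← Real.rpow_natCast, ← Real.rpow_add hd, ← Real.rpow_one_add' hd.le (by positivity)]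
    congr 1
    have := hpq.inv_add_inv_eq_one
    rw [div_eq_mul_inv, div_eq_mul_inv]
    linear_combination (n : ℝ) * this
  rw [hK] at h
  rw [← mul_le_mul_iff_left₀ (show 0 < d ^ n * v by positivity)]
  refine h.trans (le_of_eq ?_)
  linear_combination (4 * (1 - (n : ℝ) / p)⁻¹ * (2 ^ |β| * v) ^ (1 / q) * M ^ (-(γ / p)) *
    e ^ (1 / p)) * (hdd - d ^ n * d ^ (1 - (n : ℝ) / p) * inv_mul_cancel₀ hv0.ne')

/-- Decay at the boundary: `u` is compared with its vanishing values on a ball below the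
boundary. -/
theorem exists_abs_le_lastCoord_rpow {n : ℕ} (hn : 0 < n) {p γ : ℝ} (hp1 : 1 < p)
    (hnp : (n : ℝ) < p) (hγ : γ < p - 1) :
    ∃ C : ℝ, 0 < C ∧ ∀ u : EuclideanSpace ℝ (Fin n) → ℝ, ContDiff ℝ 1 u → HasCompactSupport u →
      tsupport u ⊆ upperHalf n → ∀ x ∈ upperHalf n,
        |u x| ≤ C * lastCoord n x ^ (1 - ((n : ℝ) + γ) / p) *
          (energy n γ p u).toReal ^ (1 / p) := by
  have hp0 : 0 < p := by linarith
  obtain ⟨q, hpq⟩ : ∃ q, p.HolderConjugate q := ⟨_, Real.HolderConjugate.conjExponent hp1⟩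
  have hq0 := hpq.symm.pos
  have hnp1 : 0 < 1 - (n : ℝ) / p := by linarith [(div_lt_one hp0).2 hnp]
  set β := γ / (p - 1) with hβ
  have hβ1 : β < 1 := (div_lt_one hpq.sub_one_pos).2 hγ
  have hβq : β * (1 / q) = γ / p := by
    rw [hpq.conjugate_eq, hβ]
    have := hpq.sub_one_pos
    field_simp
  set v := (volume : Measure (EuclideanSpace ℝ (Fin n))).real (Metric.ball 0 1) with hv
  have hv0 : 0 < v :=
    ENNReal.toReal_pos (Metric.measure_ball_pos _ _ one_pos).ne' measure_ball_lt_top.ne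
  obtain ⟨A, hA0, hA⟩ := exists_setLIntegral_Ioo_rpow_neg_le hβ1
  refine ⟨3 * (1 - (n : ℝ) / p)⁻¹ * (2 ^ (n - 1) * A) ^ (1 / q) / v, by positivity,
    fun u hu hc hU x hx => ?_⟩
  have hx0 : 0 < lastCoord n x := hx
  set h := lastCoord n x with hh
  set e := (energy n γ p u).toReal with he
  set i : Fin n := ⟨n - 1, Nat.sub_lt hn one_pos⟩
  have hi (z : EuclideanSpace ℝ (Fin n)) : lastCoord n z = z i := lastCoord_eq hn z
  set c : EuclideanSpace ℝ (Fin n) := x + EuclideanSpace.single i (-(2 * h)) with hcdef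
  have hcx : c - x = EuclideanSpace.single i (-(2 * h)) := by simp [hcdef]
  have hnorm : ‖c - x‖ = 2 * h := by
    rw [hcx, PiLp.norm_single, norm_neg, Real.norm_of_nonneg (by positivity)]
  have hzero : ∀ w ∈ Metric.ball c h, u w = 0 := by
    intro w hw
    refine image_eq_zero_of_notMem_tsupport fun hw' => ?_
    have h1 : 0 < lastCoord n w := hU hw'
    have h2 := (abs_le.1 (abs_lastCoord_sub_le hn w c)).2
    have h3 := mem_ball_iff_norm.1 hw
    have h4 : lastCoord n c = h - 2 * h := by
      rw [hi, hcdef, PiLp.add_apply, ← hi, PiLp.single_apply, if_pos rfl, hh]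
      ring
    linarith
  have key := setLIntegral_ball_enorm_sub_le_weighted volume hu (measurableSet_upperHalf n)
    (fun z hz => fderiv_eq_zero_of_notMem_upperHalf hU hz) (continuous_lastCoord n).measurable
    (fun z hz => hz) hpq (by simpa using hnp) (energy_ne_top (γ := γ) hp0 hu hc hU)
    (x := x) (c := c) (r := h) (R := 3 * h) (K := 2 ^ (n - 1) * A * h ^ ((n : ℝ) - β))
    (by positivity) (by linarith) (by positivity) ?_
  · rw [finrank_euclideanSpace_fin] at key
    have h0 : ∫⁻ w in Metric.ball c h, ‖u w - u c‖ₑ ≤ ENNReal.ofReal 0 := by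
      rw [setLIntegral_congr_fun (g := fun _ => 0) measurableSet_ball]
      · simp
      · intro w hw
        simp [hzero w hw, hzero c (Metric.mem_ball_self hx0)]
    have hfin := abs_sub_mul_measureReal_le hu.continuous.measurable (by positivity) le_rfl key h0
    rw [hzero c (Metric.mem_ball_self hx0), sub_zero, add_zero, measureReal_def,
      Measure.addHaar_ball_of_pos _ _ hx0, finrank_euclideanSpace_fin, ENNReal.toReal_mul,
      ENNReal.toReal_ofReal (by positivity), ← measureReal_def, ← hv] at hfin
    change _ ≤ 3 * h * (1 - n / p)⁻¹ * (2 ^ (n - 1) * A * h ^ ((n : ℝ) - β)) ^ (1 / q) *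
          e ^ (1 / p) at hfin
    have hK : (2 ^ (n - 1) * A * h ^ ((n : ℝ) - β)) ^ (1 / q) =
        (2 ^ (n - 1) * A) ^ (1 / q) * h ^ ((n : ℝ) / q - γ / p) := by
      rw [Real.mul_rpow (by positivity) (by positivity), ← Real.rpow_mul hx0.le, sub_mul, hβq,
        mul_one_div]
    have hdd : h * h ^ ((n : ℝ) / q - γ / p) = h ^ n * h ^ (1 - ((n : ℝ) + γ) / p) := by
      rw [← Real.rpow_natCast, ← Real.rpow_add hx0]
      nth_rewrite 1 [← Real.rpow_one h]
      rw [← Real.rpow_add hx0]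
      congr 1
      have := hpq.inv_add_inv_eq_one
      simp only [div_eq_mul_inv]
      linear_combination (n : ℝ) * this
    rw [hK] at hfin
    rw [← mul_le_mul_iff_left₀ (show 0 < h ^ n * v by positivity)]
    refine hfin.trans (le_of_eq ?_)
    linear_combination (3 * (1 - (n : ℝ) / p)⁻¹ * (2 ^ (n - 1) * A) ^ (1 / q) * e ^ (1 / p)) *
      (hdd - h ^ n * h ^ (1 - ((n : ℝ) + γ) / p) * inv_mul_cancel₀ hv0.ne')
  · intro s hs
    rw [finrank_euclideanSpace_fin]
    have hs0 : 0 < s := hs.1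
    have hci : (x + s • (c - x)) i = h - 2 * s * h := by
      rw [hcx, PiLp.add_apply, PiLp.smul_apply, ← hi, PiLp.single_apply, if_pos rfl,
        smul_eq_mul, hh]
      ring
    calc _ = ∫⁻ z in Metric.ball (x + s • (c - x)) (s * h),
            (Ioi 0).indicator (fun t => ENNReal.ofReal (t ^ (-β))) (z i) := by
          rw [inter_comm, ← setLIntegral_indicator (measurableSet_upperHalf n)]
          refine lintegral_congr fun z => ?_
          by_cases hz : 0 < lastCoord n z
          · rw [indicator_of_mem (show z ∈ upperHalf n from hz),
              indicator_of_mem (show z i ∈ Ioi 0 from hi z ▸ hz), hi]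
          · rw [indicator_of_notMem (show z ∉ upperHalf n from hz),
              indicator_of_notMem (show z i ∉ Ioi 0 from hi z ▸ hz)]
      _ ≤ _ := setLIntegral_ball_comp_coord_le _ _ i
          (Measurable.indicator (by fun_prop) measurableSet_Ioi)
      _ ≤ ENNReal.ofReal (2 * (s * h)) ^ (n - 1) * ENNReal.ofReal (A * s * h ^ (1 - β)) := by
          rw [Fintype.card_fin, hci, setLIntegral_indicator measurableSet_Ioi, inter_comm]
          gcongr
          exact hA h hx0 s hs
      _ = _ := by
          rw [← ENNReal.ofReal_pow (by positivity), ← ENNReal.ofReal_mul (by positivity)]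
          congr 1
          obtain ⟨m, rfl⟩ : ∃ m, n = m + 1 := ⟨n - 1, by omega⟩
          have : h ^ (((m + 1 : ℕ) : ℝ) - β) = h ^ m * h ^ (1 - β) := by
            rw [← Real.rpow_natCast, ← Real.rpow_add hx0]
            congr 1
            push_cast
            ring
          rw [this, Nat.add_sub_cancel]
          ring

theorem exists_abs_sub_le_of_lastCoord_le {n : ℕ} (hn : 2 ≤ n) {p γ : ℝ} (hnp : (n : ℝ) < p)
    (hγ : γ ≤ p - n) :
    ∃ C : ℝ, 0 < C ∧
      ∀ u : EuclideanSpace ℝ (Fin n) → ℝ,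
        ContDiff ℝ 1 u → HasCompactSupport u → tsupport u ⊆ upperHalf n →
        ∀ x ∈ upperHalf n, ∀ y ∈ upperHalf n, lastCoord n y ≤ lastCoord n x →
          |u x - u y| ≤
            C * (lastCoord n x ^ (1 - ((n : ℝ) + γ) / p) * ‖x - y‖ ^ (1 - (n : ℝ) / p) /
                max (lastCoord n x) ‖x - y‖ ^ (1 - (n : ℝ) / p)) *
              (energy n γ p u).toReal ^ (1 / p) := by
  have hn0 : 0 < n := by omega
  have hn2 : (2 : ℝ) ≤ n := by exact_mod_cast hn
  have hp0 : 0 < p := by linarith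
  obtain ⟨C₁, hC₁, h₁⟩ := exists_abs_sub_le_of_norm_sub_le hn0 γ (by linarith) hnp
  obtain ⟨C₂, hC₂, h₂⟩ := exists_abs_le_lastCoord_rpow hn0 (γ := γ) (by linarith) hnp (by linarith)
  refine ⟨C₁ + 8 * C₂, by positivity, fun u hu hc hU x hx y hy hyx => ?_⟩
  specialize h₁ u hu hc hU x hx y
  have hux := h₂ u hu hc hU x hx
  have huy := h₂ u hu hc hU y hy
  have hx0 : 0 < lastCoord n x := hx
  have hy0 : 0 < lastCoord n y := hy
  have hα : 0 < 1 - (n : ℝ) / p := by linarith [(div_lt_one hp0).2 hnp]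
  have hα1 : 1 - (n : ℝ) / p ≤ 1 := by linarith [show 0 ≤ (n : ℝ) / p by positivity]
  have hexp : 0 ≤ 1 - ((n : ℝ) + γ) / p := by
    rw [sub_nonneg, div_le_one hp0]
    linarith
  set M := lastCoord n x
  set d := ‖x - y‖ with hd
  set e := (energy n γ p u).toReal ^ (1 / p)
  have hd0 : 0 ≤ d := norm_nonneg _
  have he0 : 0 ≤ e := by positivity
  rcases le_or_gt (4 * d) M with hdM | hdM
  · refine (h₁ hdM).trans ?_
    rw [max_eq_left (by linarith)]
    have : M ^ (1 - ((n : ℝ) + γ) / p) * d ^ (1 - (n : ℝ) / p) / M ^ (1 - (n : ℝ) / p) =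
        M ^ (-(γ / p)) * d ^ (1 - (n : ℝ) / p) := by
      rw [mul_div_right_comm, ← Real.rpow_sub hx0]
      ring_nf
    rw [this]
    gcongr
    linarith
  · have hmax : max M d ≤ 4 * d := max_le hdM.le (by linarith)
    have hmax0 : 0 < max M d := lt_max_of_lt_left hx0
    have hfrac : 1 / 4 ≤ d ^ (1 - (n : ℝ) / p) / max M d ^ (1 - (n : ℝ) / p) := by
      rw [← Real.div_rpow hd0 hmax0.le]
      calc (1 / 4 : ℝ) ≤ (1 / 4) ^ (1 - (n : ℝ) / p) :=
            Real.self_le_rpow_of_le_one (by norm_num) (by norm_num) hα1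
        _ ≤ _ := Real.rpow_le_rpow (by norm_num) ((le_div_iff₀ hmax0).2 (by linarith)) hα.le
    have hyM : lastCoord n y ^ (1 - ((n : ℝ) + γ) / p) ≤ M ^ (1 - ((n : ℝ) + γ) / p) := by
      gcongr
    calc |u x - u y| ≤ |u x| + |u y| := abs_sub _ _
      _ ≤ C₂ * M ^ (1 - ((n : ℝ) + γ) / p) * e + C₂ * M ^ (1 - ((n : ℝ) + γ) / p) * e :=
          add_le_add hux (huy.trans (by gcongr))
      _ = 8 * C₂ * (M ^ (1 - ((n : ℝ) + γ) / p) * (1 / 4)) * e := by ring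
      _ ≤ _ := by
          rw [mul_div_assoc]
          gcongr
          linarith

/-- Weighted Morrey–Sobolev inequality for compactly supported functions, case `γ ≤ p - n`. -/
theorem weighted_morrey_sobolev_compact (n : ℕ) (hn : 2 ≤ n) (p γ : ℝ)
    (hnp : (n : ℝ) < p) (hγ : γ ≤ p - n) :
    ∃ C : ℝ, 0 < C ∧
      ∀ u : EuclideanSpace ℝ (Fin n) → ℝ,
        ContDiff ℝ (⊤ : ℕ∞) u → HasCompactSupport u → tsupport u ⊆ upperHalf n →
        ∀ x ∈ upperHalf n, ∀ y ∈ upperHalf n,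
          |u x - u y| ≤
            C * (max (lastCoord n x) (lastCoord n y) ^ (1 - ((n : ℝ) + γ) / p) *
                ‖x - y‖ ^ (1 - (n : ℝ) / p) /
                max (max (lastCoord n x) (lastCoord n y)) ‖x - y‖ ^ (1 - (n : ℝ) / p)) *
              (energy n γ p u).toReal ^ (1 / p) := by
  obtain ⟨C, hC, h⟩ := exists_abs_sub_le_of_lastCoord_le hn hnp hγ
  refine ⟨C, hC, fun u hu hc hU x hx y hy => ?_⟩
  have hu1 : ContDiff ℝ 1 u := hu.of_le (by exact_mod_cast le_top)
  rcases le_total (lastCoord n y) (lastCoord n x) with hyx | hxy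
  · rw [max_eq_left hyx]
    exact h u hu1 hc hU x hx y hy hyx
  · rw [max_eq_right hxy, abs_sub_comm, norm_sub_rev]
    exact h u hu1 hc hU y hy x hx hxy
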